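/- Let A be a symmetric real n×n matrix with A·𝟙 = 𝟙 (𝟙 the all-ones vector in ℝ^n), let 𝒜 = A − (1/n)·𝟙𝟙ᵀ, and suppose there is a constant 0 < λ < 1 with ‖𝒜·y‖ ≤ λ·‖y‖ for all y ∈ ℝ^n. Let 0 < φ < ρ < 1 be constants and B a real n×p matrix. Let v : ℕ → ℝ^n satisfy ‖v(k)‖ ≤ k for all sufficiently large k, and define w : ℕ → ℝ^n by w(0) = v(0) and w(k) = φ^k·v(k) − φ^{k−1}·v(k−1) for k ≥ 1. Let u : ℕ → ℝ^p be such that for every ε ∈ (0, 1−ρ) there exists a constant d_ε > 0 with ‖u(k)‖ ≤ d_ε·(ρ+ε)^k for all k ∈ ℕ. Let x : ℕ → ℝ^n satisfy x(k+1) = A·(x(k) + w(k)) + B·u(k) with arbitrary initial state x(0). Then x(k) − x̄(k) → 0 as k → ∞, where x̄(k) = (1/n)·𝟙𝟙ᵀ·x(k), and moreover limsup_{k→∞} ‖x(k) − x̄(k)‖^{1/k} ≤ max{ρ, λ}. -/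

import Mathlib

open Filter

/-- The Euclidean norm on `ℝ^n` (viewed as `Fin n → ℝ`). -/
noncomputable def euclNorm {n : ℕ} (v : Fin n → ℝ) : ℝ :=
  Real.sqrt (∑ i, v i ^ 2)

/-- The all-ones column vector in `ℝ^n`. -/
def onesVec (n : ℕ) : Fin n → ℝ := fun _ => 1

/-- The `n × n` all-ones matrix `𝟙𝟙ᵀ`. -/
def onesMat (n : ℕ) : Matrix (Fin n) (Fin n) ℝ := Matrix.of fun _ _ => 1

/-- The noisy signal `w` built from `v`: `w(0) = v(0)` and
`w(k) = φ^k·v(k) − φ^{k−1}·v(k−1)` for `k ≥ 1`. -/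
noncomputable def noiseSignal {n : ℕ} (φ : ℝ) (v : ℕ → Fin n → ℝ) :
    ℕ → Fin n → ℝ
  | 0 => v 0
  | k + 1 => φ ^ (k + 1) • v (k + 1) - φ ^ k • v k

open Topology

theorem euclNorm_eq_norm {n : ℕ} (v : Fin n → ℝ) : euclNorm v = ‖WithLp.toLp 2 v‖ := by
  simp [euclNorm, EuclideanSpace.norm_eq]

theorem euclNorm_nonneg {n : ℕ} (v : Fin n → ℝ) : 0 ≤ euclNorm v :=
  Real.sqrt_nonneg _

theorem euclNorm_add_le {n : ℕ} (v w : Fin n → ℝ) :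
    euclNorm (v + w) ≤ euclNorm v + euclNorm w := by
  simpa only [euclNorm_eq_norm, WithLp.toLp_add] using norm_add_le _ _

theorem euclNorm_sub_le {n : ℕ} (v w : Fin n → ℝ) :
    euclNorm (v - w) ≤ euclNorm v + euclNorm w := by
  simpa only [euclNorm_eq_norm, WithLp.toLp_sub] using norm_sub_le _ _

theorem euclNorm_smul {n : ℕ} (c : ℝ) (v : Fin n → ℝ) :
    euclNorm (c • v) = |c| * euclNorm v := by
  simpa only [euclNorm_eq_norm, WithLp.toLp_smul, Real.norm_eq_abs] using norm_smul c (WithLp.toLp 2 v)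

theorem abs_apply_le_euclNorm {n : ℕ} (v : Fin n → ℝ) (i : Fin n) : |v i| ≤ euclNorm v := by
  simpa only [euclNorm_eq_norm, Real.norm_eq_abs] using PiLp.norm_apply_le (WithLp.toLp 2 v) i

theorem tendsto_zero_of_euclNorm_tendsto_zero {n : ℕ} {y : ℕ → Fin n → ℝ}
    (h : Tendsto (fun k => euclNorm (y k)) atTop (𝓝 0)) : Tendsto y atTop (𝓝 0) :=
  tendsto_pi_nhds.2 fun i =>
    squeeze_zero_norm (fun k => abs_apply_le_euclNorm (y k) i) h

theorem exists_euclNorm_mulVec_le {m n : ℕ} (M : Matrix (Fin m) (Fin n) ℝ) :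
    ∃ C, 0 ≤ C ∧ ∀ v, euclNorm (M.mulVec v) ≤ C * euclNorm v := by
  refine ⟨‖(Matrix.toLpLin 2 2 M).toContinuousLinearMap‖, norm_nonneg _, fun v => ?_⟩
  rw [euclNorm_eq_norm, euclNorm_eq_norm]
  exact (Matrix.toLpLin 2 2 M).toContinuousLinearMap.le_opNorm (WithLp.toLp 2 v)

theorem onesMat_eq_vecMulVec (n : ℕ) : onesMat n = Matrix.vecMulVec (onesVec n) (onesVec n) := by
  ext i j
  simp [onesMat, onesVec, Matrix.vecMulVec_apply]

theorem mul_onesMat {n : ℕ} {A : Matrix (Fin n) (Fin n) ℝ}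
    (h : A.mulVec (onesVec n) = onesVec n) : A * onesMat n = onesMat n := by
  rw [onesMat_eq_vecMulVec, Matrix.mul_vecMulVec, h]

theorem onesMat_mul {n : ℕ} {A : Matrix (Fin n) (Fin n) ℝ} (hsymm : A.IsSymm)
    (h : A.mulVec (onesVec n) = onesVec n) : onesMat n * A = onesMat n := by
  rw [onesMat_eq_vecMulVec, Matrix.vecMulVec_mul, ← Matrix.mulVec_transpose, hsymm.eq, h]

theorem onesMat_mul_self (n : ℕ) : onesMat n * onesMat n = (n : ℝ) • onesMat n := by
  ext i j
  simp [onesMat, Matrix.mul_apply]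

/-- A nonnegative sequence contracted by `lam` and driven by a term of geometric rate
`r > lam` decays at rate `r`. -/
theorem exists_le_mul_pow_of_le_mul_add {a : ℕ → ℝ} {lam r M : ℝ} (hlam : 0 ≤ lam) (hr : lam < r)
    (h : ∀ k, a (k + 1) ≤ lam * a k + M * r ^ k) : ∃ K, ∀ k, a k ≤ K * r ^ k := by
  have hd : 0 < r - lam := sub_pos.2 hr
  refine ⟨max (a 0) (M / (r - lam)), fun k => ?_⟩
  have hK : M ≤ max (a 0) (M / (r - lam)) * (r - lam) :=
    (div_le_iff₀ hd).1 (le_max_right _ _)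
  generalize hK' : max (a 0) (M / (r - lam)) = K at hK
  induction k with
  | zero => simp [← hK']
  | succ k ih =>
    have hrk : 0 ≤ r ^ k := pow_nonneg (hlam.trans hr.le) k
    calc a (k + 1) ≤ lam * a k + M * r ^ k := h k
      _ ≤ lam * (K * r ^ k) + K * (r - lam) * r ^ k := by gcongr
      _ = K * r ^ (k + 1) := by ring

theorem limsup_rpow_one_div_le {a : ℕ → ℝ} {K r : ℝ} (ha : ∀ k, 0 ≤ a k) (hr : 0 < r)
    (h : ∀ k, a k ≤ K * r ^ k) : limsup (fun k : ℕ => a k ^ ((1 : ℝ) / k)) atTop ≤ r := by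
  have hK : 0 < max K 1 := lt_max_of_lt_right one_pos
  have hlim : Tendsto (fun k : ℕ => max K 1 ^ ((1 : ℝ) / k) * r) atTop (𝓝 r) := by
    have h1 : Tendsto (fun k : ℕ => max K 1 ^ ((1 : ℝ) / k)) atTop (𝓝 (max K 1 ^ (0 : ℝ))) :=
      (Real.continuousAt_const_rpow hK.ne').tendsto.comp tendsto_one_div_atTop_nhds_zero_nat
    simpa using h1.mul_const r
  rw [← hlim.limsup_eq]
  refine limsup_le_limsup ?_ ?_ hlim.isBoundedUnder_le
  · filter_upwards [eventually_ne_atTop 0] with k hk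
    calc a k ^ ((1 : ℝ) / k) ≤ (max K 1 * r ^ k) ^ ((1 : ℝ) / k) := by
          refine Real.rpow_le_rpow (ha k) ((h k).trans ?_) (by positivity)
          gcongr
          exact le_max_left _ _
      _ = max K 1 ^ ((1 : ℝ) / k) * r := by
          rw [Real.mul_rpow hK.le (by positivity), one_div, Real.pow_rpow_inv_natCast hr.le hk]
  · exact (isBoundedUnder_of ⟨0, fun k => Real.rpow_nonneg (ha k) _⟩ :
      IsBoundedUnder (· ≥ ·) atTop _).isCoboundedUnder_le

theorem exists_pow_mul_euclNorm_le {n : ℕ} {v : ℕ → Fin n → ℝ}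
    (hv : ∀ᶠ k : ℕ in atTop, euclNorm (v k) ≤ (k : ℝ)) {φ r : ℝ} (hφ : 0 < φ) (hr : φ < r) :
    ∃ C, 0 < C ∧ ∀ k, φ ^ k * euclNorm (v k) ≤ C * r ^ k := by
  have hr0 : 0 < r := hφ.trans hr
  have hO : (fun k => φ ^ k * euclNorm (v k)) =O[atTop] fun k : ℕ => r ^ k := by
    refine Asymptotics.IsBigO.trans (.of_bound 1 ?_)
      (isLittleO_pow_const_mul_const_pow_const_pow_of_norm_lt 1 (r₁ := φ)
        (by rwa [Real.norm_of_nonneg hφ.le])).isBigO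
    filter_upwards [hv] with k hk
    rw [Real.norm_of_nonneg (mul_nonneg (by positivity) (euclNorm_nonneg _)),
      Real.norm_of_nonneg (by positivity), one_mul, pow_one, mul_comm]
    gcongr
  obtain ⟨C, hC, h⟩ := Asymptotics.bound_of_isBigO_nat_atTop hO
  refine ⟨C, hC, fun k => ?_⟩
  have := h (x := k) (pow_pos hr0 k).ne'
  rw [Real.norm_of_nonneg (pow_pos hr0 k).le] at this
  exact (le_abs_self _).trans this

theorem exists_euclNorm_noiseSignal_le {n : ℕ} {v : ℕ → Fin n → ℝ}
    (hv : ∀ᶠ k : ℕ in atTop, euclNorm (v k) ≤ (k : ℝ)) {φ r : ℝ} (hφ : 0 < φ) (hr : φ < r) :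
    ∃ C, ∀ k, euclNorm (noiseSignal φ v k) ≤ C * r ^ k := by
  have hr0 : 0 < r := hφ.trans hr
  obtain ⟨C, hC, h⟩ := exists_pow_mul_euclNorm_le hv hφ hr
  refine ⟨C + C / r, fun k => ?_⟩
  cases k with
  | zero =>
    have h0 := h 0
    have : 0 < C / r := by positivity
    simp only [pow_zero, one_mul, mul_one] at h0 ⊢
    exact h0.trans (by linarith)
  | succ k =>
    calc euclNorm (noiseSignal φ v (k + 1))
        ≤ φ ^ (k + 1) * euclNorm (v (k + 1)) + φ ^ k * euclNorm (v k) := by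
          refine (euclNorm_sub_le _ _).trans_eq ?_
          rw [euclNorm_smul, euclNorm_smul, abs_of_pos (by positivity), abs_of_pos (by positivity)]
      _ ≤ C * r ^ (k + 1) + C * r ^ k := add_le_add (h _) (h _)
      _ = (C + C / r) * r ^ (k + 1) := by field_simp; ring

/-- The disagreement `z - z̄` after one step depends on `z` only through its own disagreement. -/
theorem disagreement_step {n : ℕ} (hn : 1 ≤ n) {A : Matrix (Fin n) (Fin n) ℝ} (hsymm : A.IsSymm)
    (hones : A.mulVec (onesVec n) = onesVec n) (z w b : Fin n → ℝ) :
    (A.mulVec (z + w) + b) - (1 / (n : ℝ)) • (onesMat n).mulVec (A.mulVec (z + w) + b) =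
      (A - (1 / (n : ℝ)) • onesMat n).mulVec
          ((z - (1 / (n : ℝ)) • (onesMat n).mulVec z) + w) +
        (1 - (1 / (n : ℝ)) • onesMat n).mulVec b := by
  have hJ : (A - (1 / (n : ℝ)) • onesMat n) * onesMat n = 0 := by
    have hn0 : (n : ℝ) ≠ 0 := by positivity
    rw [sub_mul, mul_onesMat hones, smul_mul_assoc, onesMat_mul_self, smul_smul,
      one_div_mul_cancel hn0, one_smul, sub_self]
  simp only [Matrix.mulVec_add, Matrix.mulVec_sub, Matrix.mulVec_smul, Matrix.mulVec_mulVec, hJ,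
    Matrix.zero_mulVec, smul_zero, sub_zero, Matrix.sub_mulVec, Matrix.smul_mulVec,
    onesMat_mul hsymm hones, Matrix.one_mulVec, smul_add]
  abel

/-- For the noisy consensus dynamics `x(k+1) = A(x(k) + w(k)) + B u(k)` where the
attack input decays like `(ρ+ε)^k` for every `ε ∈ (0, 1−ρ)`, the disagreement
`x(k) − x̄(k)` converges to `0`, with
`limsup_k ‖x(k) − x̄(k)‖^{1/k} ≤ max{ρ, λ}`. -/
theorem stmt_16 {n p : ℕ} (hn : 1 ≤ n)
    (A : Matrix (Fin n) (Fin n) ℝ) (hsymm : A.IsSymm)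
    (hones : A.mulVec (onesVec n) = onesVec n)
    (lam : ℝ) (hlam0 : 0 < lam) (hlam1 : lam < 1)
    (hA : ∀ y : Fin n → ℝ,
      euclNorm ((A - (1 / (n : ℝ)) • onesMat n).mulVec y) ≤ lam * euclNorm y)
    (φ ρ : ℝ) (hφ0 : 0 < φ) (hφρ : φ < ρ) (hρ1 : ρ < 1)
    (B : Matrix (Fin n) (Fin p) ℝ)
    (v : ℕ → Fin n → ℝ) (hv : ∀ᶠ k : ℕ in atTop, euclNorm (v k) ≤ (k : ℝ))
    (u : ℕ → Fin p → ℝ)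
    (hu : ∀ ε : ℝ, 0 < ε → ε < 1 - ρ → ∃ dε : ℝ, 0 < dε ∧
      ∀ k : ℕ, euclNorm (u k) ≤ dε * (ρ + ε) ^ k)
    (x : ℕ → Fin n → ℝ)
    (hx : ∀ k : ℕ, x (k + 1)
      = A.mulVec (x k + noiseSignal φ v k) + B.mulVec (u k)) :
    Tendsto (fun k : ℕ => x k - (1 / (n : ℝ)) • (onesMat n).mulVec (x k))
        atTop (nhds 0) ∧
      limsup (fun k : ℕ =>
          euclNorm (x k - (1 / (n : ℝ)) • (onesMat n).mulVec (x k))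
            ^ ((1 : ℝ) / (k : ℝ))) atTop
        ≤ max ρ lam := by
  set y : ℕ → Fin n → ℝ := fun k => x k - (1 / (n : ℝ)) • (onesMat n).mulVec (x k) with hy
  obtain ⟨C₁, hC₁0, hC₁⟩ := exists_euclNorm_mulVec_le (1 - (1 / (n : ℝ)) • onesMat n)
  obtain ⟨C₂, hC₂0, hC₂⟩ := exists_euclNorm_mulVec_le B
  have hdecay : ∀ r, max ρ lam < r → r < 1 → ∃ K, ∀ k, euclNorm (y k) ≤ K * r ^ k := by
    intro r hr hr1
    obtain ⟨hρr, hlr⟩ := max_lt_iff.1 hr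
    obtain ⟨D, hD⟩ := exists_euclNorm_noiseSignal_le hv hφ0 (hφρ.trans hρr)
    obtain ⟨d, -, hd⟩ := hu (r - ρ) (by linarith) (by linarith)
    rw [add_sub_cancel] at hd
    refine exists_le_mul_pow_of_le_mul_add (M := lam * D + C₁ * (C₂ * d)) hlam0.le hlr
      fun k => ?_
    have hstep : y (k + 1) = (A - (1 / (n : ℝ)) • onesMat n).mulVec (y k + noiseSignal φ v k) +
        (1 - (1 / (n : ℝ)) • onesMat n).mulVec (B.mulVec (u k)) := by
      simp only [hy, hx]
      exact disagreement_step hn hsymm hones _ _ _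
    calc euclNorm (y (k + 1))
        ≤ lam * (euclNorm (y k) + euclNorm (noiseSignal φ v k)) +
            C₁ * (C₂ * euclNorm (u k)) := by
          rw [hstep]
          refine (euclNorm_add_le _ _).trans (add_le_add ((hA _).trans ?_) ((hC₁ _).trans ?_))
          · gcongr
            exact euclNorm_add_le _ _
          · gcongr
            exact hC₂ _
      _ ≤ lam * (euclNorm (y k) + D * r ^ k) + C₁ * (C₂ * (d * r ^ k)) := by
          gcongr
          · exact hD k
          · exact hd k
      _ = lam * euclNorm (y k) + (lam * D + C₁ * (C₂ * d)) * r ^ k := by ring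
  have hmax : max ρ lam < 1 := max_lt hρ1 hlam1
  have hmax0 : 0 < max ρ lam := lt_max_of_lt_right hlam0
  constructor
  · obtain ⟨r, hr, hr1⟩ := exists_between hmax
    obtain ⟨K, hK⟩ := hdecay r hr hr1
    refine tendsto_zero_of_euclNorm_tendsto_zero (squeeze_zero (fun k => euclNorm_nonneg _) hK ?_)
    simpa using (tendsto_pow_atTop_nhds_zero_of_lt_one (hmax0.trans hr).le hr1).const_mul K
  · refine le_of_forall_gt_imp_ge_of_dense fun r hr => ?_
    obtain ⟨s, hs, hs1⟩ := exists_between (lt_min hr hmax)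
    obtain ⟨K, hK⟩ := hdecay s hs (hs1.trans_le (min_le_right _ _))
    exact (limsup_rpow_one_div_le (fun k => euclNorm_nonneg _) (hmax0.trans hs) hK).trans
      (hs1.le.trans (min_le_left _ _))
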